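/- Haar measure decomposition for SL(d,ℝ): for 1 ≤ r < d, writing M ∈ SL(d,ℝ) (on a full-measure set) as the product of a block lower-triangular matrix determined by its first r columns (x_{ij}) and a block upper-triangular matrix [[Id_r, Z],[0, Y]] with Y ∈ SL(d−r,ℝ), the Haar measure on SL(d,ℝ) decomposes as dμ = ∏ dx_{ij} · ∏ dz_{ij} · dμ_{SL(d−r,ℝ)}(Y), i.e., the Haar measure is, up to normalization, the product of Lebesgue measure on the x and z coordinates with Haar measure on SL(d−r,ℝ). -/

import Mathlib

open MeasureTheory

instance (m : ℕ) : TopologicalSpace (Matrix.SpecialLinearGroup (Fin m) ℝ) := by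
  unfold Matrix.SpecialLinearGroup; infer_instance

instance (a b : ℕ) : MeasurableSpace (Matrix (Fin a) (Fin b) ℝ) := by
  unfold Matrix; infer_instance

instance (m : ℕ) : MeasurableSpace (Matrix.SpecialLinearGroup (Fin m) ℝ) := by
  unfold Matrix.SpecialLinearGroup; infer_instance

namespace SLHaar

open Matrix Set

section Algebra

variable {r s : ℕ}

/-- The top `r × r` block of the first `r` columns. -/
def top (x : Fin (r + s) → Fin r → ℝ) : Matrix (Fin r) (Fin r) ℝ :=
  Matrix.of fun i j : Fin r => x (finSumFinEquiv (Sum.inl i)) j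

/-- The block lower-triangular completion of a `(r + s) × r` matrix. -/
noncomputable def lower (x : Fin (r + s) → Fin r → ℝ) : Matrix (Fin (r + s)) (Fin (r + s)) ℝ :=
  Matrix.reindex finSumFinEquiv finSumFinEquiv
    (Matrix.fromBlocks (top x) 0
      (Matrix.of fun (i : Fin s) (j : Fin r) => x (finSumFinEquiv (Sum.inr i)) j)
      (Matrix.diagonal fun i : Fin s => if (i : ℕ) = 0 then (top x).det⁻¹ else 1))

/-- The block upper-triangular factor. -/
def upper (z : Fin r → Fin s → ℝ) (Y : Matrix (Fin s) (Fin s) ℝ) :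
    Matrix (Fin (r + s)) (Fin (r + s)) ℝ :=
  Matrix.reindex finSumFinEquiv finSumFinEquiv (Matrix.fromBlocks 1 (Matrix.of z) 0 Y)

/-- The parametrization `(x, z, Y) ↦ P(x) · [[1, z], [0, Y]]`. -/
noncomputable def param (p : (Fin (r + s) → Fin r → ℝ) × (Fin r → Fin s → ℝ) ×
    Matrix.SpecialLinearGroup (Fin s) ℝ) : Matrix (Fin (r + s)) (Fin (r + s)) ℝ :=
  lower p.1 * upper p.2.1 p.2.2.val

/-- The first `r` columns of a matrix. -/
def cols (M : Matrix (Fin (r + s)) (Fin (r + s)) ℝ) : Fin (r + s) → Fin r → ℝ :=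
  fun i j => M i (finSumFinEquiv (Sum.inl j))

/-- Left multiplication by `g` on `(r + s) × r` matrices, as a linear map. -/
def act (g : Matrix (Fin (r + s)) (Fin (r + s)) ℝ) :
    (Fin (r + s) → Fin r → ℝ) →ₗ[ℝ] (Fin (r + s) → Fin r → ℝ) where
  toFun x := fun i j => (g *ᵥ fun k => x k j) i
  map_add' x y := by
    funext i j
    exact congrFun (mulVec_add g (fun k => x k j) (fun k => y k j)) i
  map_smul' c x := by
    funext i j
    exact congrFun (mulVec_smul g c (fun k => x k j)) i

lemma cols_mul (g M : Matrix (Fin (r + s)) (Fin (r + s)) ℝ) :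
    cols (g * M) = act g (cols M) := rfl

lemma cols_lower (x : Fin (r + s) → Fin r → ℝ) : cols (lower x) = x := by
  funext i j
  obtain ⟨i, rfl⟩ := finSumFinEquiv.surjective i
  cases i <;> simp only [cols, lower, reindex_apply, submatrix_apply, Equiv.symm_apply_apply,
    fromBlocks_apply₁₁, fromBlocks_apply₂₁, top, of_apply]

lemma upper_mul (z z' : Fin r → Fin s → ℝ) (Y Y' : Matrix (Fin s) (Fin s) ℝ) :
    upper z Y * upper z' Y' = upper (z' + Matrix.of.symm (Matrix.of z * Y')) (Y * Y') := by
  simp only [upper, reindex_apply, submatrix_mul_equiv, fromBlocks_multiply]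
  congr 1
  simp
  rfl

lemma cols_upper (z : Fin r → Fin s → ℝ) (Y : Matrix (Fin s) (Fin s) ℝ) :
    cols (upper z Y) = cols 1 := by
  funext i j
  obtain ⟨i, rfl⟩ := finSumFinEquiv.surjective i
  cases i with
  | inl i =>
    simp only [cols, upper, reindex_apply, submatrix_apply, Equiv.symm_apply_apply,
      fromBlocks_apply₁₁, one_apply, EmbeddingLike.apply_eq_iff_eq, Sum.inl.injEq]
  | inr i =>
    simp only [cols, upper, reindex_apply, submatrix_apply, Equiv.symm_apply_apply,
      fromBlocks_apply₂₁, one_apply, EmbeddingLike.apply_eq_iff_eq, reduceCtorEq, if_false,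
    Matrix.zero_apply]

lemma cols_param (p : (Fin (r + s) → Fin r → ℝ) × (Fin r → Fin s → ℝ) ×
    Matrix.SpecialLinearGroup (Fin s) ℝ) : cols (param p) = p.1 := by
  rw [param, cols_mul, cols_upper, ← cols_mul, mul_one, cols_lower]

lemma det_upper (z : Fin r → Fin s → ℝ) (Y : Matrix (Fin s) (Fin s) ℝ) :
    (upper z Y).det = Y.det := by
  simp [upper, det_fromBlocks_zero₂₁]

lemma det_lower (hs : 1 ≤ s) {x : Fin (r + s) → Fin r → ℝ} (hx : (top x).det ≠ 0) :
    (lower x).det = 1 := by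
  have h : ∏ i : Fin s, (if (i : ℕ) = 0 then (top x).det⁻¹ else 1) = (top x).det⁻¹ := by
    rw [Finset.prod_eq_single (⟨0, hs⟩ : Fin s)]
    · simp
    · intro b _ hb
      rw [if_neg]
      exact fun h => hb (Fin.ext h)
    · simp
  simp [lower, det_fromBlocks_zero₁₂, h, hx]

lemma det_param (hs : 1 ≤ s) {p : (Fin (r + s) → Fin r → ℝ) × (Fin r → Fin s → ℝ) ×
    Matrix.SpecialLinearGroup (Fin s) ℝ} (hx : (top p.1).det ≠ 0) : (param p).det = 1 := by
  rw [param, det_mul, det_lower hs hx, det_upper, p.2.2.property, one_mul]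

/-- The upper right block. -/
def block₁₂ (M : Matrix (Fin (r + s)) (Fin (r + s)) ℝ) : Fin r → Fin s → ℝ :=
  fun i j => M (finSumFinEquiv (Sum.inl i)) (finSumFinEquiv (Sum.inr j))

/-- The lower right block. -/
def block₂₂ (M : Matrix (Fin (r + s)) (Fin (r + s)) ℝ) : Matrix (Fin s) (Fin s) ℝ :=
  Matrix.of fun i j => M (finSumFinEquiv (Sum.inr i)) (finSumFinEquiv (Sum.inr j))

lemma block₁₂_upper (z : Fin r → Fin s → ℝ) (Y : Matrix (Fin s) (Fin s) ℝ) :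
    block₁₂ (upper z Y) = z := by
  funext i j
  simp [block₁₂, upper, -finSumFinEquiv_apply_left, -finSumFinEquiv_apply_right]

lemma block₂₂_upper (z : Fin r → Fin s → ℝ) (Y : Matrix (Fin s) (Fin s) ℝ) :
    block₂₂ (upper z Y) = Y := by
  ext i j
  simp [block₂₂, upper, -finSumFinEquiv_apply_left, -finSumFinEquiv_apply_right]

lemma eq_upper {W : Matrix (Fin (r + s)) (Fin (r + s)) ℝ} (hW : cols W = cols 1) :
    W = upper (block₁₂ W) (block₂₂ W) := by
  ext i j
  obtain ⟨j, rfl⟩ := finSumFinEquiv.surjective j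
  cases j with
  | inl j =>
    exact (congrFun (congrFun hW i) j).trans
      (congrFun (congrFun (cols_upper (block₁₂ W) (block₂₂ W)) i) j).symm
  | inr j =>
    obtain ⟨i, rfl⟩ := finSumFinEquiv.surjective i
    cases i <;> simp [block₁₂, block₂₂, upper, -finSumFinEquiv_apply_left,
      -finSumFinEquiv_apply_right]

/-- Every `M` of determinant `1` with nonvanishing top left minor is in the image of `param`. -/
lemma exists_factor (hs : 1 ≤ s) {M : Matrix (Fin (r + s)) (Fin (r + s)) ℝ} (hM : M.det = 1)
    (hx : (top (cols M)).det ≠ 0) :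
    ∃ (z : Fin r → Fin s → ℝ) (Y : Matrix.SpecialLinearGroup (Fin s) ℝ),
      M = lower (cols M) * upper z Y.val := by
  have hd := det_lower hs hx
  set W := adjugate (lower (cols M)) * M with hW
  have hc : cols W = cols 1 := by
    rw [hW, cols_mul, ← congrArg (act (lower (cols M)).adjugate) (cols_lower (cols M)),
      ← cols_mul, adjugate_mul, hd, one_smul]
  have hU := eq_upper hc
  have hdet : W.det = 1 := by
    rw [hW, det_mul, det_adjugate, hd, hM, one_pow, one_mul]
  have hY : (block₂₂ W).det = 1 := by
    rw [← hdet, ← det_upper (block₁₂ W), ← hU]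
  refine ⟨block₁₂ W, ⟨block₂₂ W, hY⟩, ?_⟩
  change M = lower (cols M) * upper (block₁₂ W) (block₂₂ W)
  rw [← hU, hW, ← mul_assoc, mul_adjugate, hd, one_smul, one_mul]

/-- Left multiplication in the coordinates `(x, z, Y)`. -/
lemma exists_mul_param (hs : 1 ≤ s) {g : Matrix (Fin (r + s)) (Fin (r + s)) ℝ} (hg : g.det = 1)
    {x : Fin (r + s) → Fin r → ℝ} (hx : (top x).det ≠ 0) (hgx : (top (act g x)).det ≠ 0) :
    ∃ (z' : Fin r → Fin s → ℝ) (Y' : Matrix.SpecialLinearGroup (Fin s) ℝ), ∀ z Y,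
      g * param (x, z, Y) =
        param (act g x, z + Matrix.of.symm (Matrix.of z' * Y.val), Y' * Y) := by
  have hc : cols (g * lower x) = act g x := by rw [cols_mul, cols_lower]
  obtain ⟨z', Y', h⟩ := exists_factor hs (M := g * lower x)
    (by rw [det_mul, hg, det_lower hs hx, one_mul]) (by rwa [hc])
  refine ⟨z', Y', fun z Y => ?_⟩
  rw [hc] at h
  simp only [param]
  rw [← mul_assoc, h, mul_assoc, upper_mul]
  rfl

lemma det_act (g : Matrix (Fin (r + s)) (Fin (r + s)) ℝ) :
    LinearMap.det (act (r := r) g) = g.det ^ r := by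
  let e : (Fin (r + s) → Fin r → ℝ) ≃ₗ[ℝ] (Fin r → Fin (r + s) → ℝ) :=
    { toFun := fun x j i => x i j
      invFun := fun x j i => x i j
      map_add' := fun _ _ => rfl
      map_smul' := fun _ _ => rfl
      left_inv := fun _ => rfl
      right_inv := fun _ => rfl }
  have h := LinearMap.det_conj (act (r := r) g) e
  rw [← h]
  have h2 := LinearMap.det_pi (fun _ : Fin r => Matrix.toLin' g)
  simp only [LinearMap.det_toLin', Finset.prod_const, Finset.card_univ, Fintype.card_fin] at h2
  rw [← h2]
  congr 1

end Algebra

section Topology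

variable (m : ℕ)

instance : BorelSpace (Matrix (Fin m) (Fin m) ℝ) :=
  inferInstanceAs (BorelSpace (Fin m → Fin m → ℝ))

instance : SecondCountableTopology (Matrix (Fin m) (Fin m) ℝ) :=
  inferInstanceAs (SecondCountableTopology (Fin m → Fin m → ℝ))

instance : LocallyCompactSpace (Matrix (Fin m) (Fin m) ℝ) :=
  inferInstanceAs (LocallyCompactSpace (Fin m → Fin m → ℝ))

lemma isClosedEmbedding_val : Topology.IsClosedEmbedding
    (fun M : Matrix.SpecialLinearGroup (Fin m) ℝ => M.val) :=
  Matrix.SpecialLinearGroup.isClosedEmbedding_val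

instance : IsTopologicalGroup (Matrix.SpecialLinearGroup (Fin m) ℝ) :=
  Matrix.SpecialLinearGroup.topologicalGroup

instance : BorelSpace (Matrix.SpecialLinearGroup (Fin m) ℝ) :=
  Subtype.borelSpace {A : Matrix (Fin m) (Fin m) ℝ | A.det = 1}

instance : SecondCountableTopology (Matrix.SpecialLinearGroup (Fin m) ℝ) :=
  (isClosedEmbedding_val m).isEmbedding.secondCountableTopology

instance : LocallyCompactSpace (Matrix.SpecialLinearGroup (Fin m) ℝ) :=
  (isClosedEmbedding_val m).locallyCompactSpace

lemma measurableEmbedding_val : MeasurableEmbedding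
    (fun M : Matrix.SpecialLinearGroup (Fin m) ℝ => M.val) :=
  (isClosedEmbedding_val m).measurableEmbedding

end Topology

section Measure

variable {r s : ℕ}

lemma continuous_top : Continuous (top (r := r) (s := s)) :=
  continuous_matrix fun _ j => (continuous_apply j).comp (continuous_apply _)

lemma continuous_cols : Continuous (cols (r := r) (s := s)) :=
  continuous_pi fun i => continuous_pi fun _ => continuous_id.matrix_elem i _

lemma measurable_lower : Measurable (lower (r := r) (s := s)) := by
  have hdet : Measurable fun x : Fin (r + s) → Fin r → ℝ => (top x).det :=
    continuous_top.matrix_det.measurable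
  refine measurable_pi_iff.2 fun i => measurable_pi_iff.2 fun j => ?_
  obtain ⟨i, rfl⟩ := finSumFinEquiv.surjective i
  obtain ⟨j, rfl⟩ := finSumFinEquiv.surjective j
  rcases i with i | i <;> rcases j with j | j <;>
    simp only [lower, top, reindex_apply, submatrix_apply, Equiv.symm_apply_apply,
      fromBlocks_apply₁₁, fromBlocks_apply₁₂, fromBlocks_apply₂₁, fromBlocks_apply₂₂,
      of_apply, Matrix.zero_apply, diagonal_apply]
  · fun_prop
  · fun_prop
  · fun_prop
  · split_ifs
    · exact hdet.inv
    · fun_prop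
    · fun_prop

lemma continuous_upper : Continuous fun p : (Fin r → Fin s → ℝ) × Matrix (Fin s) (Fin s) ℝ =>
    upper p.1 p.2 := by
  unfold upper
  simp only [reindex_apply]
  refine Continuous.matrix_submatrix (Continuous.matrix_fromBlocks continuous_const
    ?_ continuous_const continuous_snd) _ _
  exact continuous_fst

lemma measurable_param : Measurable (param (r := r) (s := s)) := by
  have h1 : Measurable fun p : (Fin (r + s) → Fin r → ℝ) × (Fin r → Fin s → ℝ) ×
      Matrix.SpecialLinearGroup (Fin s) ℝ => lower p.1 := measurable_lower.comp measurable_fst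
  have h2 : Measurable fun p : (Fin (r + s) → Fin r → ℝ) × (Fin r → Fin s → ℝ) ×
      Matrix.SpecialLinearGroup (Fin s) ℝ => upper (r := r) p.2.1 p.2.2.val :=
    (continuous_upper.comp (continuous_fst.prodMk
      ((isClosedEmbedding_val s).continuous.comp continuous_snd))).measurable.comp measurable_snd
  have h3 : Continuous fun p : Matrix (Fin (r + s)) (Fin (r + s)) ℝ ×
      Matrix (Fin (r + s)) (Fin (r + s)) ℝ => p.1 * p.2 := continuous_fst.mul continuous_snd
  exact h3.measurable.comp (h1.prodMk h2)

lemma measurePreserving_act {g : Matrix (Fin (r + s)) (Fin (r + s)) ℝ} (hg : g.det = 1) :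
    MeasurePreserving (act (r := r) g) volume volume := by
  have hd : LinearMap.det (act (r := r) g) = 1 := by rw [det_act, hg, one_pow]
  refine ⟨(act (r := r) g).continuous_of_finiteDimensional.measurable, ?_⟩
  rw [Measure.map_linearMap_addHaar_eq_smul_addHaar _ (by rw [hd]; exact one_ne_zero), hd]
  simp

lemma top_add_smul (x : Fin (r + s) → Fin r → ℝ) (t : ℝ) :
    top (x + t • cols 1) = top x + t • 1 := by
  ext i j
  simp [top, cols, one_apply, -finSumFinEquiv_apply_left]

lemma ae_det_top_ne_zero : ∀ᵐ x : Fin (r + s) → Fin r → ℝ, (top x).det ≠ 0 := by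
  set N : Set (Fin (r + s) → Fin r → ℝ) := {x | (top x).det = 0} with hN
  have hNm : MeasurableSet N :=
    continuous_top.matrix_det.measurable (measurableSet_singleton (0 : ℝ))
  suffices h : volume N = 0 by
    rw [ae_iff]; simpa using h
  have hfin (x : Fin (r + s) → Fin r → ℝ) : {t : ℝ | x + t • cols 1 ∈ N}.Finite := by
    have hp : (-top x).charpoly ≠ 0 := (charpoly_monic _).ne_zero
    refine (Polynomial.finite_setOfPred_isRoot hp).subset fun t ht => ?_
    have : (top (x + t • cols 1)).det = 0 := ht
    rw [top_add_smul] at this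
    change Polynomial.eval t (-top x).charpoly = 0
    rw [eval_charpoly, ← this]
    congr 1
    rw [sub_neg_eq_add, add_comm, scalar_apply, smul_one_eq_diagonal]
  have hmeas : Measurable fun q : ℝ × (Fin (r + s) → Fin r → ℝ) =>
      N.indicator (fun _ => (1 : ENNReal)) (q.2 + q.1 • cols 1) := by
    have : Measurable fun q : ℝ × (Fin (r + s) → Fin r → ℝ) => q.2 + q.1 • cols 1 :=
      (continuous_snd.add (continuous_fst.smul continuous_const)).measurable
    exact (measurable_const.indicator hNm).comp this
  have h1 : ∫⁻ t : ℝ, ∫⁻ x, N.indicator (fun _ => (1 : ENNReal)) (x + t • cols 1) = 0 := by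
    rw [lintegral_lintegral_swap hmeas.aemeasurable]
    simp only [lintegral_eq_zero_iff' (hmeas.lintegral_prod_left').aemeasurable]
    refine Filter.Eventually.of_forall fun x => ?_
    have : (fun t : ℝ => N.indicator (fun _ => (1 : ENNReal)) (x + t • cols 1)) =
        {t : ℝ | x + t • cols 1 ∈ N}.indicator 1 := by
      funext t
      simp [indicator]
    simp only [this, Pi.zero_apply]
    rw [lintegral_indicator_one (hfin x).measurableSet, (hfin x).measure_zero]
  have h2 (t : ℝ) : ∫⁻ x, N.indicator (fun _ => (1 : ENNReal)) (x + t • cols 1) = volume N := by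
    rw [lintegral_add_right_eq_self (fun x => N.indicator (fun _ => (1 : ENNReal)) x),
      lintegral_indicator hNm, setLIntegral_one]
  simp only [h2, lintegral_const, Real.volume_univ] at h1
  by_contra hne
  rw [ENNReal.mul_top hne] at h1
  exact ENNReal.top_ne_zero h1

variable (ν : Measure (Matrix.SpecialLinearGroup (Fin s) ℝ))

lemma lintegral_param [ν.IsHaarMeasure]
    {f : Matrix (Fin (r + s)) (Fin (r + s)) ℝ → ENNReal} (hf : Measurable f) :
    ∫⁻ M, f M ∂(Measure.map param (volume.prod (volume.prod ν))) =
      ∫⁻ x, ∫⁻ Y, ∫⁻ z, f (param (x, z, Y)) ∂volume ∂ν ∂volume := by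
  rw [lintegral_map hf measurable_param,
    lintegral_prod (fun p => f (param p)) (hf.comp measurable_param).aemeasurable]
  refine lintegral_congr fun x => ?_
  exact lintegral_prod_symm _
    ((hf.comp measurable_param).comp measurable_prodMk_left).aemeasurable

/-- The pushforward of the product measure is invariant under left multiplication. -/
lemma map_mul_left_map_param [ν.IsHaarMeasure] (hs : 1 ≤ s) {g : Matrix (Fin (r + s)) (Fin (r + s)) ℝ}
    (hg : g.det = 1) :
    Measure.map (fun M => g * M) (Measure.map param (volume.prod (volume.prod ν))) =
      Measure.map param (volume.prod (volume.prod ν)) := by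
  have hgm : Measurable fun M : Matrix (Fin (r + s)) (Fin (r + s)) ℝ => g * M :=
    (continuous_const.mul continuous_id).measurable
  refine Measure.ext_of_lintegral _ fun f hf => ?_
  rw [lintegral_map hf hgm, lintegral_param (f := fun M => f (g * M)) ν (hf.comp hgm), lintegral_param ν hf]
  have hF : Measurable fun x : Fin (r + s) → Fin r → ℝ =>
      ∫⁻ Y, ∫⁻ z, f (param (x, z, Y)) ∂volume ∂ν := by
    have h0 : Measurable fun q : ((Fin (r + s) → Fin r → ℝ) ×
        Matrix.SpecialLinearGroup (Fin s) ℝ) × (Fin r → Fin s → ℝ) =>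
        f (param (q.1.1, q.2, q.1.2)) :=
      (hf.comp measurable_param).comp (by fun_prop)
    exact (h0.lintegral_prod_right').lintegral_prod_right'
  have hpres := measurePreserving_act (r := r) hg
  rw [← hpres.lintegral_comp hF]
  refine lintegral_congr_ae ?_
  filter_upwards [ae_det_top_ne_zero, hpres.quasiMeasurePreserving.ae ae_det_top_ne_zero]
    with x hx hgx
  obtain ⟨z', Y', h⟩ := exists_mul_param hs hg hx hgx
  simp only [h]
  rw [← lintegral_mul_left_eq_self (fun Y => ∫⁻ z, f (param (act g x, z, Y)) ∂volume) Y']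
  refine lintegral_congr fun Y => ?_
  exact lintegral_add_right_eq_self (fun z => f (param (act g x, z, Y' * Y))) _

lemma continuousOn_lower :
    ContinuousOn (lower (r := r) (s := s)) {x | (top x).det ≠ 0} := by
  rw [continuousOn_iff_continuous_domRestrict]
  have hdet : Continuous fun x : {x : Fin (r + s) → Fin r → ℝ | (top x).det ≠ 0} =>
      (top x.val).det⁻¹ :=
    (continuous_top.matrix_det.comp continuous_subtype_val).inv₀ fun x => x.property
  change Continuous fun x : {x : Fin (r + s) → Fin r → ℝ | (top x).det ≠ 0} => lower x.val
  simp only [lower, reindex_apply]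
  refine Continuous.matrix_submatrix (Continuous.matrix_fromBlocks
    (continuous_top.comp continuous_subtype_val) continuous_const ?_ ?_) _ _
  · refine continuous_matrix fun i j => ?_
    exact (continuous_apply_apply (finSumFinEquiv (Sum.inr i)) j).comp continuous_subtype_val
  · refine Continuous.matrix_diagonal (continuous_pi fun i => ?_)
    split_ifs
    · exact hdet
    · exact continuous_const

/-- The coordinates `(x, z, Y)` of a matrix. -/
noncomputable def coords (M : Matrix (Fin (r + s)) (Fin (r + s)) ℝ) :
    (Fin (r + s) → Fin r → ℝ) × (Fin r → Fin s → ℝ) × Matrix (Fin s) (Fin s) ℝ :=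
  (cols M, block₁₂ (adjugate (lower (cols M)) * M), block₂₂ (adjugate (lower (cols M)) * M))

lemma continuousOn_coords :
    ContinuousOn (coords (r := r) (s := s)) {M | (top (cols M)).det ≠ 0} := by
  have h1 : ContinuousOn (fun M => lower (r := r) (s := s) (cols M))
      {M | (top (cols M)).det ≠ 0} :=
    continuousOn_lower.comp continuous_cols.continuousOn fun _ h => h
  have h2 : ContinuousOn (fun M => adjugate (lower (r := r) (s := s) (cols M)) * M)
      {M | (top (cols M)).det ≠ 0} :=
    ((continuous_id.matrix_adjugate).comp_continuousOn h1).mul continuousOn_id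
  have h3 : Continuous (block₁₂ (r := r) (s := s)) :=
    continuous_pi fun _ => continuous_pi fun _ => continuous_id.matrix_elem _ _
  have h4 : Continuous (block₂₂ (r := r) (s := s)) :=
    continuous_matrix fun _ _ => continuous_id.matrix_elem _ _
  exact continuous_cols.continuousOn.prodMk
    ((h3.comp_continuousOn h2).prodMk (h4.comp_continuousOn h2))

lemma coords_param (hs : 1 ≤ s) {p : (Fin (r + s) → Fin r → ℝ) × (Fin r → Fin s → ℝ) ×
    Matrix.SpecialLinearGroup (Fin s) ℝ} (hp : (top p.1).det ≠ 0) :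
    coords (param p) = (p.1, p.2.1, p.2.2.val) := by
  have h : adjugate (lower p.1) * param p = upper p.2.1 p.2.2.val := by
    rw [param, ← mul_assoc, adjugate_mul, det_lower hs hp, one_smul, one_mul]
  rw [coords, cols_param, h, block₁₂_upper, block₂₂_upper]

lemma measure_param_preimage_lt_top [ν.IsHaarMeasure] (hs : 1 ≤ s)
    {K : Set (Matrix (Fin (r + s)) (Fin (r + s)) ℝ)}
    (hK : IsCompact K) (hK' : ∀ M ∈ K, (top (cols M)).det ≠ 0) :
    (volume.prod (volume.prod ν)) (param ⁻¹' K) < ⊤ := by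
  have hC : IsCompact (coords '' K) := hK.image_of_continuousOn (continuousOn_coords.mono hK')
  have hemb : Topology.IsClosedEmbedding fun p : (Fin (r + s) → Fin r → ℝ) ×
      (Fin r → Fin s → ℝ) × Matrix.SpecialLinearGroup (Fin s) ℝ => (p.1, p.2.1, p.2.2.val) :=
    Topology.IsClosedEmbedding.id.prodMap
      (Topology.IsClosedEmbedding.id.prodMap (isClosedEmbedding_val s))
  refine lt_of_le_of_lt (measure_mono ?_) (hemb.isCompact_preimage hC).measure_lt_top
  intro p hp
  have hx := hK' _ hp
  rw [cols_param] at hx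
  exact ⟨param p, hp, coords_param hs hx⟩

/-- The measure on `SL(r + s, ℝ)` given by the product measure in coordinates. -/
noncomputable def coordMeasure : Measure (Matrix.SpecialLinearGroup (Fin (r + s)) ℝ) :=
  (Measure.map param (volume.prod (volume.prod ν))).comap fun M => M.val

lemma coordMeasure_apply (A : Set (Matrix.SpecialLinearGroup (Fin (r + s)) ℝ)) :
    coordMeasure ν A = (Measure.map param (volume.prod (volume.prod ν)))
      ((fun M : Matrix.SpecialLinearGroup (Fin (r + s)) ℝ => M.val) '' A) :=
  (measurableEmbedding_val _).comap_apply _ _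

lemma isMulLeftInvariant_coordMeasure [ν.IsHaarMeasure] (hs : 1 ≤ s) :
    (coordMeasure (r := r) ν).IsMulLeftInvariant := by
  refine ⟨fun g => Measure.ext fun A hA => ?_⟩
  have hgm : Measurable fun M : Matrix (Fin (r + s)) (Fin (r + s)) ℝ => g.val * M :=
    (continuous_const.mul continuous_id).measurable
  rw [Measure.map_apply (measurable_const_mul g) hA, coordMeasure_apply, coordMeasure_apply,
    ← map_mul_left_map_param ν hs g.property,
    Measure.map_apply hgm ((measurableEmbedding_val _).measurableSet_image.2 hA),
    map_mul_left_map_param ν hs g.property]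
  congr 1
  ext M
  constructor
  · rintro ⟨N, hN, rfl⟩
    exact ⟨g * N, hN, rfl⟩
  · rintro ⟨N, hN, hNM⟩
    refine ⟨g⁻¹ * N, by simpa using hN, ?_⟩
    change (g⁻¹).val * N.val = M
    have h1 : (g⁻¹).val * g.val = 1 := congrArg Subtype.val (inv_mul_cancel g)
    have h2 : N.val = g.val * M := hNM
    rw [h2, ← mul_assoc, h1, one_mul]

lemma isFiniteMeasureOnCompacts_coordMeasure [ν.IsHaarMeasure] (hs : 1 ≤ s) :
    IsFiniteMeasureOnCompacts (coordMeasure (r := r) ν) := by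
  have := isMulLeftInvariant_coordMeasure (r := r) ν hs
  have hval := (isClosedEmbedding_val (r + s)).continuous
  have hopen : IsOpen {M : Matrix.SpecialLinearGroup (Fin (r + s)) ℝ |
      (top (cols M.val)).det ≠ 0} :=
    isOpen_ne.preimage ((continuous_top.comp (continuous_cols.comp hval)).matrix_det)
  have hone : (top (cols (1 : Matrix (Fin (r + s)) (Fin (r + s)) ℝ))).det = 1 := by
    have : top (cols (1 : Matrix (Fin (r + s)) (Fin (r + s)) ℝ)) = 1 := by
      ext i j
      simp [top, cols, one_apply, -finSumFinEquiv_apply_left]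
    rw [this, det_one]
  obtain ⟨K, hK1, hKV, hK⟩ := local_compact_nhds
    (hopen.mem_nhds (show (1 : Matrix.SpecialLinearGroup (Fin (r + s)) ℝ) ∈ _ from
      hone.trans_ne one_ne_zero))
  have hfin : coordMeasure ν K < ⊤ := by
    rw [coordMeasure_apply, Measure.map_apply measurable_param (hK.image hval).measurableSet]
    refine measure_param_preimage_lt_top ν hs (hK.image hval) ?_
    rintro _ ⟨M, hM, rfl⟩
    exact hKV hM
  have : IsLocallyFiniteMeasure (coordMeasure (r := r) ν) := by
    refine ⟨fun g => ⟨(fun M => g⁻¹ * M) ⁻¹' K, ?_, ?_⟩⟩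
    · refine (continuous_const_mul g⁻¹).continuousAt.preimage_mem_nhds ?_
      simpa using hK1
    · rwa [measure_preimage_mul]
  infer_instance

lemma map_val_coordMeasure (hs : 1 ≤ s) :
    (coordMeasure (r := r) ν).map (fun M => M.val) =
      Measure.map param (volume.prod (volume.prod ν)) := by
  rw [coordMeasure, (measurableEmbedding_val _).map_comap]
  refine Measure.restrict_eq_self_of_ae_mem ?_
  refine (ae_map_iff measurable_param.aemeasurable
    (measurableEmbedding_val _).measurableSet_range).2 ?_
  filter_upwards [Measure.quasiMeasurePreserving_fst.ae ae_det_top_ne_zero] with p hp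
  exact ⟨⟨param p, det_param hs hp⟩, rfl⟩

lemma coordMeasure_ne_zero [ν.IsHaarMeasure] (hs : 1 ≤ s) : coordMeasure (r := r) ν ≠ 0 := by
  intro h
  have h1 := map_val_coordMeasure (r := r) ν hs
  rw [h, Measure.map_zero] at h1
  have h2 := (Measure.map_eq_zero_iff measurable_param.aemeasurable).1 h1.symm
  have h3 := congrArg (fun m => m (univ ×ˢ (univ ×ˢ univ))) h2
  simp only [Measure.prod_prod, Measure.coe_zero, Pi.zero_apply, mul_eq_zero,
    Measure.measure_univ_eq_zero] at h3
  rcases h3 with h3 | h3 | h3 <;> exact NeZero.ne _ h3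

end Measure

end SLHaar

/-- Haar measure decomposition for `SL(d,ℝ)` with `d = r + s`, `1 ≤ r`, `1 ≤ s` (so
`s = d - r`): writing (on a full measure set) `M = P(x) · [[Id_r, z], [0, Y]]`, where `x`
is the `d × r` matrix of the first `r` columns of `M`, `P(x)` is `x` completed by the block
`diag(det((x_{ij})_{i,j ≤ r})⁻¹, 1, …, 1)`, `z` is an `r × (d-r)` matrix and
`Y ∈ SL(d-r, ℝ)`, the Haar measure of `SL(d,ℝ)` is, up to a normalizing constant, the
pushforward of (Lebesgue in `x`) × (Lebesgue in `z`) × (Haar on `SL(d-r,ℝ)`). -/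
theorem stmt_19 (r s : ℕ) (hr : 1 ≤ r) (hs : 1 ≤ s)
    (ν : Measure (Matrix.SpecialLinearGroup (Fin s) ℝ)) [ν.IsHaarMeasure]
    (μ : Measure (Matrix.SpecialLinearGroup (Fin (r + s)) ℝ)) [μ.IsHaarMeasure]
    (T : (Fin (r + s) → Fin r → ℝ) × (Fin r → Fin s → ℝ) ×
        Matrix.SpecialLinearGroup (Fin s) ℝ → Matrix (Fin (r + s)) (Fin (r + s)) ℝ)
    (hT : ∀ x z Y, T (x, z, Y) =
      (Matrix.reindex finSumFinEquiv finSumFinEquiv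
        (Matrix.fromBlocks
          (Matrix.of fun i j : Fin r => x (finSumFinEquiv (Sum.inl i)) j)
          0
          (Matrix.of fun (i : Fin s) (j : Fin r) => x (finSumFinEquiv (Sum.inr i)) j)
          (Matrix.diagonal fun i : Fin s => if (i : ℕ) = 0 then
            ((Matrix.of fun i' j' : Fin r => x (finSumFinEquiv (Sum.inl i')) j').det)⁻¹
          else 1))) *
      (Matrix.reindex finSumFinEquiv finSumFinEquiv
        (Matrix.fromBlocks 1 (Matrix.of z) 0 Y.val))) :
    ∃ c : ENNReal, c ≠ 0 ∧ c ≠ ⊤ ∧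
      Measure.map T (volume.prod (volume.prod ν)) =
        c • (μ.map fun M : Matrix.SpecialLinearGroup (Fin (r + s)) ℝ => M.val) := by
  have hT' : T = SLHaar.param := by
    funext ⟨x, z, Y⟩
    exact hT x z Y
  have := SLHaar.isMulLeftInvariant_coordMeasure (r := r) ν hs
  have := SLHaar.isFiniteMeasureOnCompacts_coordMeasure (r := r) ν hs
  have h := Measure.isMulLeftInvariant_eq_smul (SLHaar.coordMeasure (r := r) ν) μ
  refine ⟨(SLHaar.coordMeasure (r := r) ν).haarScalarFactor μ, ?_, ENNReal.coe_ne_top, ?_⟩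
  · intro h0
    rw [ENNReal.coe_eq_zero] at h0
    rw [h0, zero_smul] at h
    exact SLHaar.coordMeasure_ne_zero ν hs h
  · rw [hT', ← SLHaar.map_val_coordMeasure ν hs]
    conv_lhs => rw [h]
    exact Measure.map_smul _ _ _
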